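/- Let C := {(x,y) ∈ ℝ² : x² + y² ≤ 1} be the closed unit ball of ℝ². Define Φ₁ : [0,1] ⇉ C by Φ₁(t) := C \ {(cos t, sin t)} for t > 0 and Φ₁(0) := C, and Φ₂ : [0,1] ⇉ C by Φ₂(t) := {(cos t, sin t)}. Then Φ₁ is lower semicontinuous with convex values and open lower sections, Φ₂ is a continuous single-valued map, Φ₁(0) ∩ ri Φ₂(0) ≠ ∅ (where ri denotes relative interior, and ri Φ₂(0) = {(1,0)}), Φ₁(t) ∩ Φ₂(t) = ∅ for t > 0 while Φ₁(0) ∩ Φ₂(0) = {(1,0)}, and consequently the intersection map t ↦ Φ₁(t) ∩ Φ₂(t) is NOT lower semicontinuous at 0. -/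

import Mathlib

open Set Topology Filter

/-- A set-valued map `Φ : X ⇉ Y` is lower semicontinuous at `x` if for every open set `Ω`
with `Φ x ∩ Ω ≠ ∅` there is a neighborhood of `x` on which `Φ x' ∩ Ω ≠ ∅`. -/
def LscAt {X Y : Type*} [TopologicalSpace X] [TopologicalSpace Y]
    (Φ : X → Set Y) (x : X) : Prop :=
  ∀ Ω : Set Y, IsOpen Ω → (Φ x ∩ Ω).Nonempty → ∀ᶠ x' in 𝓝 x, (Φ x' ∩ Ω).Nonempty

/-- A set-valued map with open lower sections is lower semicontinuous. -/
lemma lscAt_of_isOpen_lowerSection {X Y : Type*} [TopologicalSpace X] [TopologicalSpace Y]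
    {Φ : X → Set Y} (x : X) (h : ∀ y ∈ Φ x, IsOpen {t | y ∈ Φ t}) : LscAt Φ x := by
  rintro Ω - ⟨y, hy, hyΩ⟩
  filter_upwards [(h y hy).mem_nhds hy] with t ht
  exact ⟨y, ht, hyΩ⟩

lemma convex_euclidean_disc : Convex ℝ {p : ℝ × ℝ | p.1 ^ 2 + p.2 ^ 2 ≤ 1} := by
  have h : ConvexOn ℝ univ fun p : ℝ × ℝ => p.1 ^ 2 + p.2 ^ 2 :=
    ((even_two.convexOn_pow (𝕜 := ℝ)).comp_linearMap (LinearMap.fst ℝ ℝ ℝ)).add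
      ((even_two.convexOn_pow (𝕜 := ℝ)).comp_linearMap (LinearMap.snd ℝ ℝ ℝ))
  simpa using h.convex_le 1

/-- Every point of the unit circle is an extreme point of the closed unit disc. -/
lemma mem_extremePoints_euclidean_disc {c : ℝ × ℝ} (hc : c.1 ^ 2 + c.2 ^ 2 = 1) :
    c ∈ {p : ℝ × ℝ | p.1 ^ 2 + p.2 ^ 2 ≤ 1}.extremePoints ℝ := by
  refine ⟨hc.le, ?_⟩
  rintro ⟨p₁, p₂⟩ hp ⟨q₁, q₂⟩ hq ⟨a, b, ha, hb, hab, rfl⟩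
  obtain rfl : a = 1 - b := by linarith
  simp only [mem_ofPred_eq, Prod.smul_mk, smul_eq_mul, Prod.mk_add_mk] at hp hq hc ⊢
  have key : (1 - b) * b * ((p₁ - q₁) ^ 2 + (p₂ - q₂) ^ 2) ≤ 0 := by
    nlinarith [mul_le_mul_of_nonneg_left hp ha.le, mul_le_mul_of_nonneg_left hq hb.le]
  have hdist : (p₁ - q₁) ^ 2 + (p₂ - q₂) ^ 2 ≤ 0 :=
    nonpos_of_mul_nonpos_right key (mul_pos ha hb)
  have h₁ : p₁ = q₁ := by nlinarith [sq_nonneg (p₁ - q₁), sq_nonneg (p₂ - q₂)]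
  have h₂ : p₂ = q₂ := by nlinarith [sq_nonneg (p₁ - q₁), sq_nonneg (p₂ - q₂)]
  subst h₁ h₂
  ext <;> ring

/-- Example 3.3: on the closed unit ball `C` of `ℝ²`, with `Φ₁ 0 = C`,
`Φ₁ t = C \ {(cos t, sin t)}` for `t > 0`, and `Φ₂ t = {(cos t, sin t)}`: `Φ₁` is lower
semicontinuous with convex values and open lower sections, `Φ₂` is a continuous
single-valued map, `Φ₁ 0 ∩ ri (Φ₂ 0) ≠ ∅` (with `ri (Φ₂ 0) = {(1,0)}`),
`Φ₁ t ∩ Φ₂ t = ∅` for `t > 0` while `Φ₁ 0 ∩ Φ₂ 0 = {(1,0)}`, and the intersection map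
`t ↦ Φ₁ t ∩ Φ₂ t` is not lower semicontinuous at `0`. -/
theorem example_relativeInterior_fails
    (C : Set (ℝ × ℝ)) (hC : C = {p : ℝ × ℝ | p.1 ^ 2 + p.2 ^ 2 ≤ 1})
    (Φ₁ Φ₂ : Set.Icc (0 : ℝ) 1 → Set (ℝ × ℝ))
    (hΦ₁0 : ∀ t : Set.Icc (0 : ℝ) 1, (t : ℝ) = 0 → Φ₁ t = C)
    (hΦ₁pos : ∀ t : Set.Icc (0 : ℝ) 1, 0 < (t : ℝ) →
      Φ₁ t = C \ {(Real.cos (t : ℝ), Real.sin (t : ℝ))})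
    (hΦ₂ : ∀ t : Set.Icc (0 : ℝ) 1, Φ₂ t = {(Real.cos (t : ℝ), Real.sin (t : ℝ))}) :
    (∀ t : Set.Icc (0 : ℝ) 1, LscAt Φ₁ t) ∧
    (∀ t : Set.Icc (0 : ℝ) 1, Convex ℝ (Φ₁ t)) ∧
    (∀ y ∈ C, IsOpen {t : Set.Icc (0 : ℝ) 1 | y ∈ Φ₁ t}) ∧
    Continuous (fun t : Set.Icc (0 : ℝ) 1 => ((Real.cos (t : ℝ), Real.sin (t : ℝ)) : ℝ × ℝ)) ∧
    intrinsicInterior ℝ (Φ₂ ⟨0, by norm_num⟩) = {((1 : ℝ), (0 : ℝ))} ∧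
    (Φ₁ ⟨0, by norm_num⟩ ∩ intrinsicInterior ℝ (Φ₂ ⟨0, by norm_num⟩)).Nonempty ∧
    (∀ t : Set.Icc (0 : ℝ) 1, 0 < (t : ℝ) → Φ₁ t ∩ Φ₂ t = ∅) ∧
    Φ₁ ⟨0, by norm_num⟩ ∩ Φ₂ ⟨0, by norm_num⟩ = {((1 : ℝ), (0 : ℝ))} ∧
    ¬ LscAt (fun t => Φ₁ t ∩ Φ₂ t) ⟨0, by norm_num⟩ := by
  have cos_sin_mem (t : ℝ) : (Real.cos t, Real.sin t) ∈ C := by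
    simp [hC]
  have hsub (t : Set.Icc (0 : ℝ) 1) : Φ₁ t ⊆ C := by
    rcases t.2.1.eq_or_lt with h | h
    · exact (hΦ₁0 t h.symm).subset
    · exact (hΦ₁pos t h).trans_subset sdiff_subset
  have hopen : ∀ y ∈ C, IsOpen {t : Set.Icc (0 : ℝ) 1 | y ∈ Φ₁ t} := by
    intro y hy
    have hmem (t : Set.Icc (0 : ℝ) 1) (ht : y ∉ Φ₁ t) : y = (Real.cos t, Real.sin t) := by
      rcases t.2.1.eq_or_lt with h | h
      · exact absurd hy (hΦ₁0 t h.symm ▸ ht)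
      · rw [hΦ₁pos t h] at ht
        by_contra hne
        exact ht ⟨hy, hne⟩
    have hIcc (t : Set.Icc (0 : ℝ) 1) : (t : ℝ) ∈ Icc (0 : ℝ) Real.pi :=
      ⟨t.2.1, by linarith [t.2.2, Real.pi_gt_three]⟩
    have hss : {t : Set.Icc (0 : ℝ) 1 | y ∈ Φ₁ t}ᶜ.Subsingleton := fun t ht s hs =>
      Subtype.ext <| Real.injOn_cos (hIcc t) (hIcc s) <|
        congrArg Prod.fst ((hmem t ht).symm.trans (hmem s hs))
    exact isClosed_compl_iff.1 hss.isClosed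
  have hdisj (t : Set.Icc (0 : ℝ) 1) (ht : 0 < (t : ℝ)) : Φ₁ t ∩ Φ₂ t = ∅ := by
    rw [hΦ₁pos t ht, hΦ₂ t, sdiff_inter_self]
  have h10 : ((1 : ℝ), (0 : ℝ)) ∈ C := by simpa using cos_sin_mem 0
  have hΦ₂0 : Φ₂ ⟨0, by norm_num⟩ = {((1 : ℝ), (0 : ℝ))} := by simp [hΦ₂]
  have hΦ₁z : Φ₁ ⟨0, by norm_num⟩ = C := hΦ₁0 _ rfl
  have hinter : Φ₁ ⟨0, by norm_num⟩ ∩ Φ₂ ⟨0, by norm_num⟩ = {((1 : ℝ), (0 : ℝ))} := by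
    rw [hΦ₁z, hΦ₂0, inter_eq_right, singleton_subset_iff]
    exact h10
  refine ⟨fun t => lscAt_of_isOpen_lowerSection t fun y hy => hopen y (hsub t hy), fun t => ?_,
    hopen, by fun_prop, by rw [hΦ₂0, intrinsicInterior_singleton], ?_, hdisj, hinter, fun h => ?_⟩
  · rcases t.2.1.eq_or_lt with ht | ht
    · rw [hΦ₁0 t ht.symm, hC]
      exact convex_euclidean_disc
    · rw [hΦ₁pos t ht, hC]
      exact (convex_euclidean_disc.mem_extremePoints_iff_convex_sdiff.1
        (mem_extremePoints_euclidean_disc (Real.cos_sq_add_sin_sq t))).2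
  · rw [hΦ₂0, intrinsicInterior_singleton, hΦ₁z]
    exact ⟨_, h10, rfl⟩
  · have hev := h univ isOpen_univ (by simp only [inter_univ, hinter, singleton_nonempty])
    obtain ⟨ε, hε, hball⟩ := Metric.eventually_nhds_iff.1 hev
    have hpos : 0 < min (ε / 2) 1 := by positivity
    have hne := hball (y := ⟨min (ε / 2) 1, hpos.le, min_le_right _ _⟩) (by
      rw [Subtype.dist_eq, Real.dist_eq, sub_zero, abs_of_pos hpos]
      linarith [min_le_left (ε / 2) 1])
    have hempty := hdisj ⟨min (ε / 2) 1, hpos.le, min_le_right _ _⟩ hpos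
    simp only [hempty, empty_inter, Set.not_nonempty_empty] at hne
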